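/- Let M be a finite functional causal model on a directed graph G = (V,E), let G^s ∈ F(G) be a classical teleportation graph with post-selection vertex set T, and let M^s be a teleportation fCM on G^s constructed from M. If P_succ > 0 (the model is not inconsistent), then for every joint assignment x = {x_v ∈ X_v}_{v∈V}: P_acyc(x | {t_T = 1}_{T∈T})_{G^s} = (Σ_u Π_{v∈V} p^v(u_v) δ_{x_v, f^v(x_{pa(v)}, u_v)}) / (Σ_y Σ_u Π_{v∈V} p^v(u_v) δ_{y_v, f^v(y_{pa(v)}, u_v)}), where y ranges over all joint assignments {y_v ∈ X_v}_{v∈V} and u over {u_v ∈ U_v}_{v∈V}. -/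

import Mathlib

open Finset

noncomputable section

/-- The Kronecker delta `δ_{x,y}` as a real number: `1` if `x = y` and `0` otherwise. -/
def kron {α : Type*} (x y : α) : ℝ := by
  classical exact if x = y then 1 else 0

/-- A probability distribution on a finite type: values in `[0,1]` summing to `1`. -/
def IsProbDist {α : Type*} [Fintype α] (p : α → ℝ) : Prop :=
  (∀ a, 0 ≤ p a ∧ p a ≤ 1) ∧ ∑ a, p a = 1

/-- A directed graph (vertex type `V`, edge relation `E`) is acyclic if it contains no
directed cycle. -/
def Acyclic {V : Type*} (E : V → V → Prop) : Prop :=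
  ∀ v, ¬ Relation.TransGen E v v

/-- A finite functional causal model (fCM) on a directed graph `G = (V, E)` with finite
vertex set: each vertex `v` carries a nonempty finite set `X v` of values, a finite set
`U v` of error values with a probability distribution `pU v`, and a function
`f v : X_{pa(v)} × U_v → X_v` (the dependence on the parents `pa(v) = {w : E w v}` is
encoded by giving `f v` access to the values of all `w` with `E w v`). -/
structure FCM (V : Type) [Fintype V] [DecidableEq V] (E : V → V → Prop) where
  X : V → Type
  fintX : ∀ v, Fintype (X v)
  neX : ∀ v, Nonempty (X v)
  U : V → Type
  fintU : ∀ v, Fintype (U v)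
  pU : ∀ v, U v → ℝ
  pU_mem : ∀ v u, 0 ≤ pU v u ∧ pU v u ≤ 1
  pU_sum : ∀ v, letI := fintU v; (∑ u, pU v u) = 1
  f : ∀ v, (∀ w, E w v → X w) → U v → X v

attribute [instance] FCM.fintX FCM.neX FCM.fintU

variable {V : Type} [Fintype V] [DecidableEq V] {E : V → V → Prop}

/-- The number of solutions `N(u)` of an fCM for a valuation `u` of the error variables. -/
def FCM.Nsol (M : FCM V E) (u : ∀ v, M.U v) : ℝ :=
  ∑ x : ∀ v, M.X v, ∏ v, kron (M.f v (fun w _ => x w) (u v)) (x v)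

/-- The average number of solutions `N̄ = Σ_u N(u) Π_v p^v(u_v)` of an fCM. -/
def FCM.Nbar (M : FCM V E) : ℝ :=
  ∑ u : ∀ v, M.U v, M.Nsol u * ∏ v, M.pU v (u v)

/-- The data of a teleportation fCM on the classical teleportation graph `G^s` obtained from
an fCM `M` by splitting the vertices of `S`: for each split vertex `v ∈ S`, the
pre-selection vertex `R_v` carries the set `X v` with distribution `qC v`, and the
post-selection vertex `T_v` carries the set `{0,1}` with error set `B v` (distributed as
`qB v`) and function `τ v : X v × B v × X v → {0,1}`, such that `(τ v, qB v, qC v)` is a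
classical post-selected teleportation protocol with success probability `lam v ∈ (0,1]`. -/
structure TeleProto {V : Type} [Fintype V] [DecidableEq V] {E : V → V → Prop}
    (M : FCM V E) (S : Finset V) where
  B : V → Type
  fintB : ∀ v, Fintype (B v)
  qB : ∀ v, B v → ℝ
  qC : ∀ v, M.X v → ℝ
  tau : ∀ v, M.X v → B v → M.X v → Fin 2
  lam : V → ℝ
  qB_dist : ∀ v ∈ S, letI := fintB v; IsProbDist (qB v)
  qC_dist : ∀ v ∈ S, IsProbDist (qC v)
  lam_mem : ∀ v ∈ S, 0 < lam v ∧ lam v ≤ 1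
  proto : ∀ v ∈ S, ∀ p : M.X v → ℝ, IsProbDist p → ∀ c : M.X v,
    letI := fintB v;
    (∑ a, ∑ b, p a * kron (tau v a b c) 1 * qB v b * qC v c) = lam v * p c

attribute [instance] TeleProto.fintB

/-- The input to the functions of the teleportation fCM: for each split vertex `w ∈ S`, the
pre-selection vertex `R_w` (with value `r w`) substitutes `w` as input to the functions of
the children of `w`. -/
def teleArg (M : FCM V E) (S : Finset V)
    (x : ∀ v, M.X v) (r : ∀ v : {w // w ∈ S}, M.X v.1) : ∀ v, M.X v :=
  fun v => if h : v ∈ S then r ⟨v, h⟩ else x v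

/-- The acyclic probability rule applied to the teleportation fCM: the joint probability
`P_acyc(x, r, t)_{G^s}` of values `x` on the original vertices, `r` on the pre-selection
vertices and `t` on the post-selection vertices. -/
def telePacyc (M : FCM V E) (S : Finset V) (T : TeleProto M S)
    (x : ∀ v, M.X v) (r : ∀ v : {w // w ∈ S}, M.X v.1)
    (t : {w // w ∈ S} → Fin 2) : ℝ :=
  ∑ u : ∀ v, M.U v, ∑ b : ∀ v : {w // w ∈ S}, T.B v.1,
    (∏ v, M.pU v (u v) * kron (x v) (M.f v (fun w _ => teleArg M S x r w) (u v))) *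
    ∏ v : {w // w ∈ S},
      T.qC v.1 (r v) * T.qB v.1 (b v) * kron (t v) (T.tau v.1 (x v.1) (b v) (r v))

/-- The post-selection success probability
`P_succ = P_acyc({t_{T_v} = 1}_{v ∈ S})_{G^s} = Σ_{x,r} P_acyc(x, r, {t_{T_v} = 1})_{G^s}`. -/
def Psucc (M : FCM V E) (S : Finset V) (T : TeleProto M S) : ℝ :=
  ∑ x : ∀ v, M.X v, ∑ r : ∀ v : {w // w ∈ S}, M.X v.1,
    telePacyc M S T x r fun _ => 1

/-- The conditional probability `P_acyc(x | {t_T = 1}_{T ∈ 𝒯})_{G^s}` of a joint assignment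
`x` on the original vertices given successful post-selection (the pre-selection values being
marginalized). -/
def Pcond (M : FCM V E) (S : Finset V) (T : TeleProto M S) (x : ∀ v, M.X v) : ℝ :=
  (∑ r : ∀ v : {w // w ∈ S}, M.X v.1, telePacyc M S T x r fun _ => 1) / Psucc M S T

theorem kron_self {α : Type*} (a : α) : kron a a = 1 := by
  simp [kron]

theorem kron_of_ne {α : Type*} {a b : α} (h : a ≠ b) : kron a b = 0 := by
  simp [kron, h]

theorem kron_comm {α : Type*} (a b : α) : kron a b = kron b a := by
  by_cases h : a = b
  · rw [h]
  · rw [kron_of_ne h, kron_of_ne (Ne.symm h)]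

theorem sum_kron_mul {α : Type*} [Fintype α] (a : α) (g : α → ℝ) :
    ∑ b, kron a b * g b = g a := by
  classical
  simp [kron]

theorem isProbDist_kron {α : Type*} [Fintype α] (a : α) : IsProbDist (kron a) := by
  classical
  refine ⟨fun b => ?_, by simp [kron]⟩
  by_cases h : a = b <;> simp [kron, h]

/-- Applied to a deterministic input `a`, a teleportation protocol transmits `c` only if
`c = a`, and then with its success probability. -/
theorem TeleProto.sum_qB {M : FCM V E} {S : Finset V} (T : TeleProto M S) {v : V}
    (hv : v ∈ S) (a c : M.X v) :
    ∑ b, T.qC v c * T.qB v b * kron 1 (T.tau v a b c) = T.lam v * kron a c := by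
  rw [← T.proto v hv (kron a) (isProbDist_kron a) c]
  simp only [mul_assoc, ← Finset.mul_sum]
  rw [sum_kron_mul, Finset.mul_sum]
  refine Finset.sum_congr rfl fun b _ => ?_
  rw [kron_comm]
  ring

theorem teleArg_restrict (M : FCM V E) (S : Finset V) (x : ∀ v, M.X v) :
    teleArg M S x (fun v => x v.1) = x := by
  funext v
  simp [teleArg]

theorem telePacyc_one (M : FCM V E) (S : Finset V) (T : TeleProto M S)
    (x : ∀ v, M.X v) (r : ∀ v : {w // w ∈ S}, M.X v.1) :
    telePacyc M S T x r (fun _ => 1) =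
      (∏ v : {w // w ∈ S}, T.lam v.1 * kron (x v.1) (r v)) *
        ∑ u : ∀ v, M.U v,
          ∏ v, M.pU v (u v) * kron (x v) (M.f v (fun w _ => teleArg M S x r w) (u v)) := by
  unfold telePacyc
  simp_rw [← Finset.mul_sum]
  rw [← Finset.sum_mul, mul_comm]
  congr 1
  simp_rw [← T.sum_qB (Subtype.prop _)]
  rw [Finset.prod_univ_sum, Fintype.piFinset_univ]

/-- Up to the total success probability of the protocols, the joint probability of `x` and
successful post-selection is the weight of `x` in the original model. -/
theorem sum_telePacyc_one (M : FCM V E) (S : Finset V) (T : TeleProto M S)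
    (x : ∀ v, M.X v) :
    ∑ r : ∀ v : {w // w ∈ S}, M.X v.1, telePacyc M S T x r (fun _ => 1) =
      (∏ v : {w // w ∈ S}, T.lam v.1) *
        ∑ u : ∀ v, M.U v,
          ∏ v, M.pU v (u v) * kron (x v) (M.f v (fun w _ => x w) (u v)) := by
  rw [Fintype.sum_eq_single (fun v : {w // w ∈ S} => x v.1)]
  · simp only [telePacyc_one, teleArg_restrict, kron_self, mul_one]
  · intro r hr
    obtain ⟨v, hv⟩ := Function.ne_iff.mp hr
    rw [telePacyc_one, Finset.prod_eq_zero (Finset.mem_univ v), zero_mul]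
    rw [kron_of_ne hv.symm, mul_zero]

/-- **alternative formulation of the probability rule.**
Let `M` be a finite functional causal model on a directed graph `G = (V, E)`, let
`G^s ∈ F(G)` be a classical teleportation graph with split vertex set `S` (so that removing
all outgoing edges of vertices in `S` yields an acyclic graph) and post-selection vertex
set `𝒯`, and let `M^s` be a teleportation fCM on `G^s` constructed from `M`.  If
`P_succ > 0` (the model is not inconsistent), then for every joint assignment `x`:
`P_acyc(x | {t_T = 1}_{T∈𝒯})_{G^s}`
`= (Σ_u Π_v p^v(u_v) δ_{x_v, f^v(x_{pa(v)}, u_v)}) / (Σ_y Σ_u Π_v p^v(u_v) δ_{y_v, f^v(y_{pa(v)}, u_v)})`. -/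
theorem conditional_probability_alternative_formulation
    {V : Type} [Fintype V] [DecidableEq V] {E : V → V → Prop}
    (M : FCM V E) (S : Finset V)
    (hS : Acyclic fun a b : V => E a b ∧ a ∉ S)
    (T : TeleProto M S)
    (hsucc : 0 < Psucc M S T) :
    ∀ x : ∀ v, M.X v,
      Pcond M S T x =
        (∑ u : ∀ v, M.U v,
            ∏ v, M.pU v (u v) * kron (x v) (M.f v (fun w _ => x w) (u v))) /
          (∑ y : ∀ v, M.X v, ∑ u : ∀ v, M.U v,
            ∏ v, M.pU v (u v) * kron (y v) (M.f v (fun w _ => y w) (u v))) := by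
  intro x
  have hlam : (∏ v : {w // w ∈ S}, T.lam v.1) ≠ 0 :=
    Finset.prod_ne_zero_iff.mpr fun v _ => (T.lam_mem v.1 v.2).1.ne'
  simp only [Pcond, Psucc, sum_telePacyc_one]
  rw [← Finset.mul_sum, mul_div_mul_left _ _ hlam]
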